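/- arXiv:2103.12267 — 3 statements merged into one kernel-verified Lean document; each statement's English description precedes it below -/
import Mathlib

section
/- Let K₁ and K₂ be complex Hilbert spaces with fundamental symmetries J₁ and J₂ respectively, with Krein inner products [h,k]_j := ⟨h, J_j k⟩ for j = 1,2. Let {η_x^1,…,η_x^n}_{x∈M} be a continuous frame of rank n for (K₁,[·,·]₁) with respect to a measure space (M,𝔅,μ) and with frame bounds 0 < a ≤ b, and let A : K₁ → K₂ be a bounded bijective linear operator (hence with bounded inverse A⁻¹). Then {Aη_x^1,…,Aη_x^n}_{x∈M} is a continuous frame of rank n for (K₂,[·,·]₂) with respect to (M,𝔅,μ) with frame bounds a·‖A⁻¹‖⁻² ≤ b·‖A‖², i.e. a‖A⁻¹‖⁻²‖k‖² ≤ ∑_{i=1}^n ∫_M |[Aη_x^i, k]₂|² dμ(x) ≤ b‖A‖²‖k‖² for all k ∈ K₂. -/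
open MeasureTheory
open scoped InnerProductSpace

/-- A self-adjoint involution of a Hilbert space preserves the norm. -/
theorem norm_apply_of_isSelfAdjoint_involutive
    {K : Type*} [NormedAddCommGroup K] [InnerProductSpace ℂ K] [CompleteSpace K]
    {J : K →L[ℂ] K} (hJsa : IsSelfAdjoint J) (hJ2 : ∀ k : K, J (J k) = k) (k : K) :
    ‖J k‖ = ‖k‖ := by
  have h : ⟪J k, J k⟫_ℂ = ⟪k, k⟫_ℂ := by
    rw [← ContinuousLinearMap.adjoint_inner_right, hJsa.adjoint_eq, hJ2]
  rw [@norm_eq_sqrt_re_inner ℂ, h, ← @norm_eq_sqrt_re_inner ℂ]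

/-- If `{η_x^i}` is a continuous frame of rank `n` for the Krein space
`(K₁, [·,·]₁)`, `[h,k]₁ = ⟪h, J₁ k⟫_ℂ`, with bounds `0 < a ≤ b`, and `A : K₁ → K₂` is a
bounded bijective operator with bounded inverse `A⁻¹`, then `{A η_x^i}` is a continuous
frame of rank `n` for the Krein space `(K₂, [·,·]₂)`, `[h,k]₂ = ⟪h, J₂ k⟫_ℂ`, with
frame bounds `a·‖A⁻¹‖⁻² ≤ b·‖A‖²`. -/
theorem continuousFrame_similar
    {K₁ : Type*} [NormedAddCommGroup K₁] [InnerProductSpace ℂ K₁] [CompleteSpace K₁]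
    {K₂ : Type*} [NormedAddCommGroup K₂] [InnerProductSpace ℂ K₂] [CompleteSpace K₂]
    (J₁ : K₁ →L[ℂ] K₁) (hJ₁sa : IsSelfAdjoint J₁) (hJ₁2 : ∀ k : K₁, J₁ (J₁ k) = k)
    (J₂ : K₂ →L[ℂ] K₂) (hJ₂sa : IsSelfAdjoint J₂) (hJ₂2 : ∀ k : K₂, J₂ (J₂ k) = k)
    {M : Type*} [MeasurableSpace M] (μ : Measure M)
    (n : ℕ) (η : Fin n → M → K₁)
    (hmeas : ∀ (i : Fin n) (k : K₁), Measurable fun x : M => ⟪η i x, k⟫_ℂ)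
    (a b : ℝ) (ha : 0 < a) (hab : a ≤ b)
    (hframe : ∀ k : K₁,
      a * ‖k‖ ^ 2 ≤ ∑ i : Fin n, ∫ x, ‖⟪η i x, J₁ k⟫_ℂ‖ ^ 2 ∂μ ∧
      ∑ i : Fin n, ∫ x, ‖⟪η i x, J₁ k⟫_ℂ‖ ^ 2 ∂μ ≤ b * ‖k‖ ^ 2)
    (A : K₁ →L[ℂ] K₂) (Ainv : K₂ →L[ℂ] K₁)
    (hA₁ : A ∘L Ainv = 1) (hA₂ : Ainv ∘L A = 1) :
    (∀ (i : Fin n) (k : K₂), Measurable fun x : M => ⟪A (η i x), k⟫_ℂ) ∧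
    ∀ k : K₂,
      a * (‖Ainv‖ ^ 2)⁻¹ * ‖k‖ ^ 2 ≤
        ∑ i : Fin n, ∫ x, ‖⟪A (η i x), J₂ k⟫_ℂ‖ ^ 2 ∂μ ∧
      ∑ i : Fin n, ∫ x, ‖⟪A (η i x), J₂ k⟫_ℂ‖ ^ 2 ∂μ ≤ b * ‖A‖ ^ 2 * ‖k‖ ^ 2 := by
  refine ⟨fun i k => ?_, fun k => ?_⟩
  · simpa only [ContinuousLinearMap.adjoint_inner_right] using
      hmeas i (ContinuousLinearMap.adjoint A k)
  set v : K₁ := ContinuousLinearMap.adjoint A (J₂ k) with hv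
  have hinner : ∀ h : K₁, ⟪A h, J₂ k⟫_ℂ = ⟪h, J₁ (J₁ v)⟫_ℂ := fun h => by
    rw [hJ₁2, hv, ContinuousLinearMap.adjoint_inner_right]
  have hJ₂k : ‖J₂ k‖ = ‖k‖ := norm_apply_of_isSelfAdjoint_involutive hJ₂sa hJ₂2 k
  have hupper : ‖v‖ ≤ ‖A‖ * ‖k‖ := by
    simpa only [LinearIsometryEquiv.norm_map, hJ₂k] using
      (ContinuousLinearMap.adjoint A).le_opNorm (J₂ k)
  have hrecover : ContinuousLinearMap.adjoint Ainv v = J₂ k := by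
    rw [hv, ← ContinuousLinearMap.comp_apply, ← ContinuousLinearMap.adjoint_comp, hA₁]
    refine ext_inner_left ℂ fun w => ?_
    rw [ContinuousLinearMap.adjoint_inner_right, one_apply_eq_self]
  have hlower : ‖k‖ ≤ ‖Ainv‖ * ‖v‖ := by
    simpa only [LinearIsometryEquiv.norm_map, hrecover, hJ₂k] using
      (ContinuousLinearMap.adjoint Ainv).le_opNorm v
  obtain ⟨hl, hu⟩ := hframe (J₁ v)
  rw [norm_apply_of_isSelfAdjoint_involutive hJ₁sa hJ₁2] at hl hu
  simp only [hinner]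
  refine ⟨le_trans ?_ hl, hu.trans ?_⟩
  · rw [mul_assoc]
    refine mul_le_mul_of_nonneg_left ?_ ha.le
    refine inv_mul_le_of_le_mul₀ (by positivity) (by positivity) ?_
    rw [← mul_pow]
    gcongr
  · rw [mul_assoc, ← mul_pow]
    have hb : 0 ≤ b := ha.le.trans hab
    gcongr
end

section
/- Let K be a complex Hilbert space with fundamental symmetry J, [h,k] := ⟨h, J k⟩, let {η_x^1,…,η_x^n}_{x∈M} be a continuous frame of rank n for (K,[·,·]) with frame bounds 0 < a ≤ b and frame operator S (bijective with bounded inverse). Then {S⁻¹η_x^1,…,S⁻¹η_x^n}_{x∈M} is a continuous frame of rank n for (K,[·,·]) with frame bounds b⁻¹ ≤ a⁻¹, i.e. b⁻¹‖k‖² ≤ ∑_{i=1}^n ∫_M |[S⁻¹η_x^i, k]|² dμ(x) ≤ a⁻¹‖k‖² for all k ∈ K, and it is a dual frame of {η_x^i}: for all h, k ∈ K, [h,k] = ∑_{i=1}^n ∫_M [η_x^i, k] · [h, S⁻¹η_x^i] dμ(x). -/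
open MeasureTheory
open scoped InnerProductSpace

/-- If a symmetric operator `T` satisfies `a ≤ T ≤ b` in the sense of quadratic forms, then the
form `⟪y, T y⟫` is bounded below by `b⁻¹ ‖T y‖²` and above by `a⁻¹ ‖T y‖²`. -/
theorem inner_self_bounds_of_symmetric
    {K : Type*} [NormedAddCommGroup K] [InnerProductSpace ℂ K]
    (T : K →L[ℂ] K) (hT : ∀ x y : K, ⟪x, T y⟫_ℂ = ⟪T x, y⟫_ℂ) (a b : ℝ) (ha : 0 < a) (hb : 0 < b)
    (hlow : ∀ y : K, a * ‖y‖ ^ 2 ≤ (⟪y, T y⟫_ℂ).re)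
    (hup : ∀ y : K, (⟪y, T y⟫_ℂ).re ≤ b * ‖y‖ ^ 2) (y : K) :
    b⁻¹ * ‖T y‖ ^ 2 ≤ (⟪y, T y⟫_ℂ).re ∧ (⟪y, T y⟫_ℂ).re ≤ a⁻¹ * ‖T y‖ ^ 2 := by
  have hself : (⟪T y, T y⟫_ℂ).re = ‖T y‖ ^ 2 := inner_self_eq_norm_sq (𝕜 := ℂ) (T y)
  constructor
  · have hpos : 0 ≤ (⟪y - ((b⁻¹ : ℝ) : ℂ) • T y, T (y - ((b⁻¹ : ℝ) : ℂ) • T y)⟫_ℂ).re :=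
      le_trans (by positivity) (hlow _)
    have hexp : (⟪y - ((b⁻¹ : ℝ) : ℂ) • T y, T (y - ((b⁻¹ : ℝ) : ℂ) • T y)⟫_ℂ).re
        = (⟪y, T y⟫_ℂ).re - 2 * (b⁻¹ * ‖T y‖ ^ 2) + b⁻¹ * (b⁻¹ * (⟪T y, T (T y)⟫_ℂ).re) := by
      rw [map_sub, map_smul, inner_sub_left, inner_sub_right, inner_sub_right, inner_smul_left,
        inner_smul_left, inner_smul_right, inner_smul_right, hT y (T y), Complex.conj_ofReal]
      simp only [Complex.sub_re, Complex.re_ofReal_mul, hself]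
      ring
    have hTT : b⁻¹ * (b⁻¹ * (⟪T y, T (T y)⟫_ℂ).re) ≤ b⁻¹ * ‖T y‖ ^ 2 := by
      gcongr
      rw [inv_mul_le_iff₀ hb]
      exact hup _
    linarith
  · have hcs : (⟪y, T y⟫_ℂ).re ≤ ‖y‖ * ‖T y‖ := re_inner_le_norm (𝕜 := ℂ) y (T y)
    have hy := hlow y
    rw [← div_eq_inv_mul, le_div_iff₀ ha]
    nlinarith [sq_nonneg (a * ‖y‖ - ‖T y‖)]

/-- If `{η_x^i}` is a continuous frame of rank `n` for the Krein space
`(K, [·,·])`, `[h,k] = ⟪h, J k⟫_ℂ`, with bounds `0 < a ≤ b` and frame operator `S`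
(bijective with bounded inverse `S⁻¹`), then `{S⁻¹η_x^i}` is a continuous frame with
bounds `b⁻¹ ≤ a⁻¹`, and it is a dual frame:
`[h,k] = ∑_i ∫ [η_x^i, k]·[h, S⁻¹η_x^i] dμ` for all `h, k`. -/
theorem dual_frame_Sinv
    {K : Type*} [NormedAddCommGroup K] [InnerProductSpace ℂ K] [CompleteSpace K]
    (J : K →L[ℂ] K) (hJsa : IsSelfAdjoint J) (hJ2 : ∀ k : K, J (J k) = k)
    {M : Type*} [MeasurableSpace M] (μ : Measure M)
    (n : ℕ) (η : Fin n → M → K)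
    (hmeas : ∀ (i : Fin n) (k : K), Measurable fun x : M => ⟪η i x, k⟫_ℂ)
    (a b : ℝ) (ha : 0 < a) (hab : a ≤ b)
    (hframe : ∀ k : K,
      a * ‖k‖ ^ 2 ≤ ∑ i : Fin n, ∫ x, ‖⟪η i x, J k⟫_ℂ‖ ^ 2 ∂μ ∧
      ∑ i : Fin n, ∫ x, ‖⟪η i x, J k⟫_ℂ‖ ^ 2 ∂μ ≤ b * ‖k‖ ^ 2)
    (S : K →L[ℂ] K)
    (hS : ∀ k₁ k₂ : K,
      ⟪k₁, J (S k₂)⟫_ℂ = ∑ i : Fin n, ∫ x, ⟪k₁, J (η i x)⟫_ℂ * ⟪η i x, J k₂⟫_ℂ ∂μ)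
    (Sinv : K →L[ℂ] K) (hSinv₁ : S ∘L Sinv = 1) (hSinv₂ : Sinv ∘L S = 1) :
    (∀ (i : Fin n) (k : K), Measurable fun x : M => ⟪Sinv (η i x), k⟫_ℂ) ∧
    (∀ k : K,
      b⁻¹ * ‖k‖ ^ 2 ≤ ∑ i : Fin n, ∫ x, ‖⟪Sinv (η i x), J k⟫_ℂ‖ ^ 2 ∂μ ∧
      ∑ i : Fin n, ∫ x, ‖⟪Sinv (η i x), J k⟫_ℂ‖ ^ 2 ∂μ ≤ a⁻¹ * ‖k‖ ^ 2) ∧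
    (∀ h k : K,
      ⟪h, J k⟫_ℂ = ∑ i : Fin n, ∫ x, ⟪η i x, J k⟫_ℂ * ⟪h, J (Sinv (η i x))⟫_ℂ ∂μ) := by
  have hb : 0 < b := ha.trans_le hab
  have hJ : ∀ x y : K, ⟪J x, y⟫_ℂ = ⟪x, J y⟫_ℂ := hJsa.isSymmetric
  have hSSinv : ∀ x, S (Sinv x) = x := fun x => congrArg (fun f : K →L[ℂ] K => f x) hSinv₁
  have hSinvS : ∀ x, Sinv (S x) = x := fun x => congrArg (fun f : K →L[ℂ] K => f x) hSinv₂
  have hJnorm : ∀ x, ‖J x‖ ^ 2 = ‖x‖ ^ 2 := fun x => by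
    rw [← inner_self_eq_norm_sq (𝕜 := ℂ), hJ, hJ2, inner_self_eq_norm_sq]
  have hsymm : ∀ x y : K, ⟪x, J (S y)⟫_ℂ = ⟪J (S x), y⟫_ℂ := fun x y => by
    rw [← inner_conj_symm (J (S x)) y, hS, hS, map_sum]
    refine Finset.sum_congr rfl fun i _ => ?_
    rw [← integral_conj]
    refine integral_congr_ae (.of_forall fun t => ?_)
    simp only [map_mul, inner_conj_symm]
    rw [hJ, ← hJ x, mul_comm]
  have hquad : ∀ k : K, (⟪k, J (S k)⟫_ℂ).re = ∑ i : Fin n, ∫ x, ‖⟪η i x, J k⟫_ℂ‖ ^ 2 ∂μ :=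
    fun k => by
    have hint : ∀ i t, ⟪k, J (η i t)⟫_ℂ * ⟪η i t, J k⟫_ℂ = ((‖⟪η i t, J k⟫_ℂ‖ ^ 2 : ℝ) : ℂ) :=
      fun i t => by
      rw [← hJ k, ← inner_conj_symm (J k), Complex.conj_mul', Complex.ofReal_pow]
    simp only [hS, hint, integral_complex_ofReal, ← Complex.ofReal_sum, Complex.ofReal_re]
  have hadj : ∀ x y : K, ⟪Sinv x, J y⟫_ℂ = ⟪x, J (Sinv y)⟫_ℂ := fun x y => by
    have h := hsymm (Sinv x) (Sinv y)
    rwa [hSSinv, hSSinv, hJ] at h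
  refine ⟨fun i k => ?_, fun k => ?_, fun h k => ?_⟩
  · simpa only [ContinuousLinearMap.adjoint_inner_right] using
      hmeas i (ContinuousLinearMap.adjoint Sinv k)
  · have hbounds := inner_self_bounds_of_symmetric (J ∘L S) hsymm a b ha hb
      (fun y => (hframe y).1.trans_eq (hquad y).symm)
      (fun y => (hquad y).trans_le (hframe y).2) (Sinv k)
    simp only [ContinuousLinearMap.comp_apply, hSSinv, hJnorm] at hbounds
    simp only [hadj, ← hquad, hSSinv]
    rwa [hadj] at hbounds
  · have hdual := hS (Sinv h) k
    rw [hadj, hSinvS] at hdual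
    rw [hdual]
    refine Finset.sum_congr rfl fun i _ => integral_congr_ae (.of_forall fun t => ?_)
    simp only [hadj]
    rw [mul_comm]
end

section
/- Let H be a complex Hilbert space and let W : H → H be a bounded self-adjoint injective operator with 0 in the spectrum of W, and let |W| denote the absolute value of W (the positive square root of W∘W). Then for every ε > 0 there exists k ∈ H with k ≠ 0 such that ‖W k‖² ≤ ε · ⟨k, |W| k⟩. -/
open scoped InnerProductSpace

/-- If `W` is a bounded self-adjoint injective operator on a complex
Hilbert space `H` with `0 ∈ spec(W)`, and `|W|` is its absolute value (the positive
square root of `W∘W`), then for every `ε > 0` there is a nonzero `k ∈ H` with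
`‖W k‖² ≤ ε·⟪k, |W| k⟫`. -/
theorem W_norm_not_bounded_below_by_J_norm
    {H : Type*} [NormedAddCommGroup H] [InnerProductSpace ℂ H] [CompleteSpace H]
    (W : H →L[ℂ] H) (hWsa : IsSelfAdjoint W) (hWinj : Function.Injective W)
    (hspec : (0 : ℂ) ∈ spectrum ℂ W)
    (absW : H →L[ℂ] H) (habs_pos : absW.IsPositive) (habs_sq : absW ∘L absW = W ∘L W) :
    ∀ ε : ℝ, 0 < ε → ∃ k : H, k ≠ 0 ∧ ‖W k‖ ^ 2 ≤ ε * (⟪k, absW k⟫_ℂ).re := by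
  intro ε hε
  by_contra! hlt
  have hP : 0 ≤ absW := (ContinuousLinearMap.nonneg_iff_isPositive absW).2 habs_pos
  set S : H →L[ℂ] H := CFC.sqrt absW
  have hSS : S * S = absW := CFC.sqrt_mul_sqrt_self absW hP
  have hSsa : IsSelfAdjoint S := IsSelfAdjoint.of_nonneg (CFC.sqrt_nonneg absW)
  have hWsym := hWsa.isSymmetric
  have hPsym := habs_pos.isSelfAdjoint.isSymmetric
  have hSsym := hSsa.isSymmetric
  have hsq (x : H) : absW (absW x) = W (W x) := DFunLike.congr_fun habs_sq x
  have hSS' (x : H) : S (S x) = absW x := DFunLike.congr_fun hSS x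
  have hnorm (x : H) : ‖W x‖ ^ 2 = ‖S (S x)‖ ^ 2 := by
    have h : ⟪W x, W x⟫_ℂ = ⟪absW x, absW x⟫_ℂ := by
      rw [show ⟪W x, W x⟫_ℂ = ⟪x, W (W x)⟫_ℂ from hWsym x (W x),
        show ⟪absW x, absW x⟫_ℂ = ⟪x, absW (absW x)⟫_ℂ from hPsym x (absW x), hsq]
    rw [inner_self_eq_norm_sq_to_K, inner_self_eq_norm_sq_to_K] at h
    rw [hSS']
    exact_mod_cast h
  have hquad (x : H) : (⟪x, absW x⟫_ℂ).re = ‖S x‖ ^ 2 := by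
    rw [← hSS', show ⟪x, S (S x)⟫_ℂ = ⟪S x, S x⟫_ℂ from (hSsym x (S x)).symm]
    exact inner_self_eq_norm_sq (𝕜 := ℂ) (S x)
  have hSinj : LinearMap.ker (S : H →ₗ[ℂ] H) = ⊥ := by
    refine LinearMap.ker_eq_bot'.2 fun x hx => hWinj (hWinj ?_)
    have hx' : S x = 0 := hx
    rw [← hsq, ← hSS' x, hx']
    simp
  have hdense : DenseRange S := by
    have h := ContinuousLinearMap.orthogonal_range S
    rw [hSsa.adjoint_eq, hSinj] at h
    exact (Submodule.dense_iff_topologicalClosure_eq_top).2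
      ((Submodule.topologicalClosure_eq_top_iff).2 h)
  have hbound (y : H) : ε * ‖y‖ ^ 2 ≤ ‖S y‖ ^ 2 := by
    refine hdense.induction_on (p := fun y => ε * ‖y‖ ^ 2 ≤ ‖S y‖ ^ 2) y
      (isClosed_le (by fun_prop) (by fun_prop)) fun x => ?_
    rcases eq_or_ne x 0 with rfl | hx
    · simp
    · rw [← hnorm, ← hquad]
      exact (hlt x hx).le
  have hPunit : IsUnit absW := by
    refine ContinuousLinearMap.isUnit_of_forall_le_norm_inner_map absW
      (c := ⟨ε, hε.le⟩) hε fun x => ?_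
    calc ‖x‖ ^ 2 * ε ≤ ‖S x‖ ^ 2 := by rw [mul_comm]; exact hbound x
      _ = (⟪x, absW x⟫_ℂ).re := (hquad x).symm
      _ ≤ ‖⟪x, absW x⟫_ℂ‖ := Complex.re_le_norm _
      _ = ‖⟪absW x, x⟫_ℂ‖ := norm_inner_symm _ _
  have hWW : IsUnit (W * W) := by
    rw [show W * W = absW * absW from habs_sq.symm]
    exact hPunit.mul hPunit
  exact (spectrum.zero_mem_iff ℂ).1 hspec (isUnit_mul_self_iff.1 hWW)
end
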